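/- Fix α, β ∈ ℂ and let m ⊆ gl(4,ℂ) be the span of X₁, X₂, X₃, X₄. An element x₁X₁ + x₂X₂ + x₃X₃ + x₄X₄ of m is nilpotent if and only if x₁ + x₂ + x₄ = 0; in particular the nilpotent elements of m form a 3-dimensional linear subspace. -/

import Mathlib

open Matrix

/-- The matrix `X₁` of the family `h_{α,β}`. -/
noncomputable def X1 (α β : ℂ) : Matrix (Fin 4) (Fin 4) ℂ :=
  !![1, 1, 0, 1;
     1, 1, 0, 0;
     α, β, 0, 0;
     0, 0, 0, 0]

/-- The matrix `X₂` of the family `h_{α,β}`. -/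
noncomputable def X2 (α β : ℂ) : Matrix (Fin 4) (Fin 4) ℂ :=
  !![1,     1,     0, 0;
     1,     1,     0, 1;
     β - 1, α + 1, 0, 0;
     0,     0,     0, 0]

/-- The matrix `X₃` of the family `h_{α,β}`. -/
noncomputable def X3 : Matrix (Fin 4) (Fin 4) ℂ :=
  !![0, 0, 0, 0;
     0, 0, 0, 0;
     0, 0, 0, 1;
     0, 0, 0, 0]

/-- The matrix `X₄`. -/
noncomputable def X4 (α β : ℂ) : Matrix (Fin 4) (Fin 4) ℂ :=
  !![1,           1,           0, 1/2;
     1,           1,           0, 1/2;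
     (α + β)/2,   (α + β)/2,   0, (α + β)/4;
     0,           0,           0, 0]

/-- The linear combination of `X₁, X₂, X₃, X₄` written out entrywise. -/
lemma combination_eq (α β x₁ x₂ x₃ x₄ : ℂ) :
    x₁ • X1 α β + x₂ • X2 α β + x₃ • X3 + x₄ • X4 α β =
      !![x₁ + x₂ + x₄, x₁ + x₂ + x₄, 0, x₁ + x₄ / 2;
         x₁ + x₂ + x₄, x₁ + x₂ + x₄, 0, x₂ + x₄ / 2;
         x₁ * α + x₂ * (β - 1) + x₄ * ((α + β) / 2),
           x₁ * β + x₂ * (α + 1) + x₄ * ((α + β) / 2), 0, x₃ + x₄ * ((α + β) / 4);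
         0, 0, 0, 0] := by
  ext i j
  fin_cases i <;> fin_cases j <;> simp [X1, X2, X3, X4] <;> ring

lemma isNilpotent_of_zero_block (p q r u v : ℂ) :
    IsNilpotent !![0, 0, 0, p; 0, 0, 0, q; u, v, 0, r; (0 : ℂ), 0, 0, 0] := by
  refine ⟨3, ?_⟩
  ext i j
  fin_cases i <;> fin_cases j <;> simp [pow_succ, Matrix.mul_apply, Fin.sum_univ_four]

lemma isNilpotent_combination_iff (α β x₁ x₂ x₃ x₄ : ℂ) :
    IsNilpotent (x₁ • X1 α β + x₂ • X2 α β + x₃ • X3 + x₄ • X4 α β) ↔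
      x₁ + x₂ + x₄ = 0 := by
  rw [combination_eq]
  constructor
  · intro h
    have ht := (Matrix.isNilpotent_trace_of_isNilpotent h).eq_zero
    simpa [Matrix.trace, Fin.sum_univ_four] using ht
  · intro h
    rw [h]
    exact isNilpotent_of_zero_block _ _ _ _ _

lemma linearIndependent_nilpotent_basis (α β : ℂ) :
    LinearIndependent ℂ ![X1 α β - X4 α β, X2 α β - X4 α β, X3] := by
  rw [Fintype.linearIndependent_iff]
  intro g hg
  have e : g 0 • X1 α β + g 1 • X2 α β + g 2 • X3 + (-(g 0) - g 1) • X4 α β = 0 := by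
    rw [← hg]
    simp only [Fin.sum_univ_three, Matrix.cons_val]
    module
  rw [combination_eq] at e
  have h03 := congrFun₂ e 0 3
  have h20 := congrFun₂ e 2 0
  have h23 := congrFun₂ e 2 3
  simp at h03 h20 h23
  have h1 : g 1 = 0 := by linear_combination (α - β) * h03 - h20
  have h0 : g 0 = 0 := by linear_combination 2 * h03 + h1
  have h2 : g 2 = 0 := by
    linear_combination h23 + (α + β) / 4 * h0 + (α + β) / 4 * h1
  intro i
  fin_cases i
  exacts [h0, h1, h2]

/-- An element `x₁X₁ + x₂X₂ + x₃X₃ + x₄X₄` of `m = span {X₁, X₂, X₃, X₄}` is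
nilpotent iff `x₁ + x₂ + x₄ = 0`; in particular the nilpotent elements of `m` form a
3-dimensional linear subspace. -/
theorem nilpotent_elements_of_m (α β : ℂ) :
    (∀ x₁ x₂ x₃ x₄ : ℂ,
      IsNilpotent (x₁ • X1 α β + x₂ • X2 α β + x₃ • X3 + x₄ • X4 α β) ↔
        x₁ + x₂ + x₄ = 0) ∧
    ∃ W : Submodule ℂ (Matrix (Fin 4) (Fin 4) ℂ),
      (↑W = {A : Matrix (Fin 4) (Fin 4) ℂ |
        A ∈ Submodule.span ℂ ({X1 α β, X2 α β, X3, X4 α β} :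
          Set (Matrix (Fin 4) (Fin 4) ℂ)) ∧ IsNilpotent A}) ∧
      Module.finrank ℂ W = 3 := by
  refine ⟨isNilpotent_combination_iff α β,
    Submodule.span ℂ (Set.range ![X1 α β - X4 α β, X2 α β - X4 α β, X3]), ?_, ?_⟩
  · ext A
    simp only [SetLike.mem_coe, Set.mem_ofPred_eq]
    constructor
    · intro hA
      obtain ⟨c, rfl⟩ := (Submodule.mem_span_range_iff_exists_fun ℂ).1 hA
      have e : ∑ i, c i • ![X1 α β - X4 α β, X2 α β - X4 α β, X3] i =
          c 0 • X1 α β + c 1 • X2 α β + c 2 • X3 + (-(c 0) - c 1) • X4 α β := by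
        simp only [Fin.sum_univ_three, Matrix.cons_val]
        module
      rw [e, isNilpotent_combination_iff]
      refine ⟨?_, by ring⟩
      simp only [Submodule.mem_span_insert, Submodule.mem_span_singleton]
      exact ⟨c 0, _, ⟨c 1, _, ⟨c 2, _, ⟨_, rfl⟩, rfl⟩, rfl⟩, by abel⟩
    · rintro ⟨hA, hn⟩
      simp only [Submodule.mem_span_insert, Submodule.mem_span_singleton] at hA
      obtain ⟨a, _, ⟨b, _, ⟨c, _, ⟨d, rfl⟩, rfl⟩, rfl⟩, rfl⟩ := hA
      have hd : a + b + d = 0 := by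
        rw [← isNilpotent_combination_iff α β a b c d]
        convert hn using 1
        abel
      obtain rfl : d = -a - b := by linear_combination hd
      refine (Submodule.mem_span_range_iff_exists_fun ℂ).2 ⟨![a, b, c], ?_⟩
      simp only [Fin.sum_univ_three, Matrix.cons_val]
      module
  · rw [finrank_span_eq_card (linearIndependent_nilpotent_basis α β), Fintype.card_fin]
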